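/- arXiv:1809.06933 — 3 statements merged into one kernel-verified Lean document; each statement's English description precedes it below -/
import Mathlib

section
/- Let q < 6 and let z₁, …, z_q ∈ ℝ³. Suppose G ∈ ℝ^{3×3} is a symmetric positive definite matrix satisfying zₜᵀ G zₜ = 1 for all t = 1, …, q. Then there exists a symmetric positive definite matrix G' ∈ ℝ^{3×3} with G' ≠ G such that zₜᵀ G' zₜ = 1 for all t = 1, …, q. In other words, the normalizing matrix G cannot be uniquely determined from fewer than 6 observations. -/
open Matrix

lemma exists_sym_kernel (q : ℕ) (hq : q < 6) (z : Fin q → Fin 3 → ℝ) :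
    ∃ H : Matrix (Fin 3) (Fin 3) ℝ, H ≠ 0 ∧ H.IsHermitian ∧
      ∀ t : Fin q, (z t) ⬝ᵥ H.mulVec (z t) = 0 := by
  let S : (Fin 6 → ℝ) → Matrix (Fin 3) (Fin 3) ℝ := fun a =>
    !![a 0, a 1, a 2; a 1, a 3, a 4; a 2, a 4, a 5]
  let L : (Fin 6 → ℝ) →ₗ[ℝ] (Fin q → ℝ) :=
    { toFun := fun a t => (z t) ⬝ᵥ (S a).mulVec (z t)
      map_add' := by
        intro a b
        ext t
        simp [S, dotProduct, mulVec, Fin.sum_univ_three]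
        ring
      map_smul' := by
        intro c a
        ext t
        simp [S, dotProduct, mulVec, Fin.sum_univ_three]
        ring }
  have hk : LinearMap.ker L ≠ ⊥ := by
    apply LinearMap.ker_ne_bot_of_finrank_lt
    simpa using hq
  obtain ⟨a, ha, ha0⟩ := (Submodule.ne_bot_iff _).1 hk
  refine ⟨S a, ?_, ?_, ?_⟩
  · intro h
    apply ha0
    have e := fun i j => congrFun (congrFun h i) j
    have h0 := e 0 0
    have h1 := e 0 1
    have h2 := e 0 2
    have h3 := e 1 1
    have h4 := e 1 2
    have h5 := e 2 2
    simp [S] at h0 h1 h2 h3 h4 h5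
    ext i
    fin_cases i <;> simp [*]
  · ext i j
    fin_cases i <;> fin_cases j <;> simp [S]
  · intro t
    exact congrFun (LinearMap.mem_ker.1 ha) t

lemma exists_perturb (G H : Matrix (Fin 3) (Fin 3) ℝ) (hG : G.PosDef) (hH : H.IsHermitian) :
    ∃ e : ℝ, 0 < e ∧ (G + e • H).PosDef := by
  have hc : ∀ M : Matrix (Fin 3) (Fin 3) ℝ, Continuous fun x : Fin 3 → ℝ => x ⬝ᵥ M.mulVec x := by
    intro M
    simp only [dotProduct, mulVec]
    fun_prop
  have hK : IsCompact (Metric.sphere (0 : Fin 3 → ℝ) 1) := isCompact_sphere _ _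
  have hne : (Metric.sphere (0 : Fin 3 → ℝ) 1).Nonempty :=
    NormedSpace.sphere_nonempty.2 zero_le_one
  obtain ⟨u, hu, hmin⟩ := hK.exists_isMinOn hne (hc G).continuousOn
  obtain ⟨v, hv, hmin'⟩ := hK.exists_isMinOn hne (hc H).continuousOn
  have hu0 : u ≠ 0 := by
    rintro rfl
    simp at hu
  have hm : 0 < u ⬝ᵥ G.mulVec u := by simpa using hG.dotProduct_mulVec_pos hu0
  set m := u ⬝ᵥ G.mulVec u with hmdef
  set c := v ⬝ᵥ H.mulVec v with hcdef
  have hcp : 0 < |c| + 1 := by positivity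
  refine ⟨m / (|c| + 1), by positivity, ?_⟩
  have hep : 0 < m / (|c| + 1) := by positivity
  have hem : m / (|c| + 1) * (|c| + 1) = m := by field_simp
  set e := m / (|c| + 1)
  refine PosDef.of_dotProduct_mulVec_pos (hG.isHermitian.add ?_) ?_
  · rw [IsHermitian, conjTranspose_smul, hH.eq]
    simp
  intro x hx
  have hn : 0 < ‖x‖ := norm_pos_iff.2 hx
  have hy : ‖x‖⁻¹ • x ∈ Metric.sphere (0 : Fin 3 → ℝ) 1 := by
    simp [norm_smul, hn.ne']
  have h1 := isMinOn_iff.1 hmin _ hy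
  have h2 := isMinOn_iff.1 hmin' _ hy
  have hxe : x = ‖x‖ • (‖x‖⁻¹ • x) := by
    rw [smul_smul, mul_inv_cancel₀ hn.ne', one_smul]
  set y := ‖x‖⁻¹ • x
  have h3 : 0 < y ⬝ᵥ G.mulVec y + e * (y ⬝ᵥ H.mulVec y) := by
    have := neg_abs_le c
    have h4 : -|c| ≤ y ⬝ᵥ H.mulVec y := by linarith
    have h5 := mul_le_mul_of_nonneg_left h4 hep.le
    nlinarith
  have : star x ⬝ᵥ ((G + e • H) *ᵥ x) =
      ‖x‖ * ‖x‖ * (y ⬝ᵥ G.mulVec y + e * (y ⬝ᵥ H.mulVec y)) := by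
    rw [star_trivial]
    clear_value y
    generalize ‖x‖ = r at hxe ⊢
    rw [hxe]
    simp only [add_mulVec, smul_mulVec, mulVec_smul, dotProduct_add, dotProduct_smul,
      smul_dotProduct, smul_eq_mul]
    ring
  rw [this]
  positivity





/-- If `q < 6` and `G` is a symmetric positive definite matrix with
`zₜᵀ G zₜ = 1` for all `t`, then there is another symmetric positive definite
matrix `G' ≠ G` satisfying the same conditions: `G` is not unique. -/
theorem stmt5 (q : ℕ) (hq : q < 6) (z : Fin q → Fin 3 → ℝ)
    (G : Matrix (Fin 3) (Fin 3) ℝ) (hG : G.PosDef)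
    (hGz : ∀ t : Fin q, (z t) ⬝ᵥ G.mulVec (z t) = 1) :
    ∃ G' : Matrix (Fin 3) (Fin 3) ℝ, G'.PosDef ∧ G' ≠ G ∧
      ∀ t : Fin q, (z t) ⬝ᵥ G'.mulVec (z t) = 1 := by
  obtain ⟨H, hH0, hH, hHz⟩ := exists_sym_kernel q hq z
  obtain ⟨e, he, hP⟩ := exists_perturb G H hG hH
  refine ⟨G + e • H, hP, ?_, ?_⟩
  · intro h
    have : e • H = 0 := by simpa using h
    rcases smul_eq_zero.1 this with h | h
    · exact he.ne' h
    · exact hH0 h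
  · intro t
    simp only [add_mulVec, smul_mulVec, dotProduct_add, dotProduct_smul, hGz, hHz]
    simp
end

section
/- Let δ > 0, let θ₁, …, θ_q ∈ [0, 2π), and set ℓₜ = (1+δ²)^{-1/2} (cos θₜ, sin θₜ, δ)ᵀ ∈ ℝ³ for t = 1, …, q. Let H ∈ ℝ^{q×6} be the matrix whose t-th row is (ℓ_{1t}², ℓ_{2t}², ℓ_{3t}², 2ℓ_{1t}ℓ_{2t}, 2ℓ_{1t}ℓ_{3t}, 2ℓ_{2t}ℓ_{3t}). Then the third column of H is a linear combination of the first two columns; specifically, for every t, ℓ_{3t}² = δ² (ℓ_{1t}² + ℓ_{2t}²). Consequently rank(H) ≤ 5. -/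
open Matrix Real

/-- For lights `ℓₜ = (1+δ²)^{-1/2}(cos θₜ, sin θₜ, δ)ᵀ` placed on a circle, the
third column of the matrix `H` (with rows
`(ℓ₁ₜ², ℓ₂ₜ², ℓ₃ₜ², 2ℓ₁ₜℓ₂ₜ, 2ℓ₁ₜℓ₃ₜ, 2ℓ₂ₜℓ₃ₜ)`) is a linear combination of the
first two: `ℓ₃ₜ² = δ²(ℓ₁ₜ² + ℓ₂ₜ²)` for all `t`, hence `rank H ≤ 5`. -/
theorem stmt6 (q : ℕ) (δ : ℝ) (hδ : 0 < δ)
    (θ : Fin q → ℝ) (hθ : ∀ t, θ t ∈ Set.Ico 0 (2 * π))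
    (ℓ : Fin q → Fin 3 → ℝ)
    (hℓ : ∀ t, ℓ t = fun i => (Real.sqrt (1 + δ^2))⁻¹ * ![cos (θ t), sin (θ t), δ] i)
    (H : Matrix (Fin q) (Fin 6) ℝ)
    (hH : ∀ t, H t = ![(ℓ t 0)^2, (ℓ t 1)^2, (ℓ t 2)^2,
      2 * ℓ t 0 * ℓ t 1, 2 * ℓ t 0 * ℓ t 2, 2 * ℓ t 1 * ℓ t 2]) :
    (∀ t, (ℓ t 2)^2 = δ^2 * ((ℓ t 0)^2 + (ℓ t 1)^2)) ∧ H.rank ≤ 5 := by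
  have key : ∀ t, (ℓ t 2)^2 = δ^2 * ((ℓ t 0)^2 + (ℓ t 1)^2) := by
    intro t
    have h0 : ℓ t 0 = (Real.sqrt (1 + δ^2))⁻¹ * cos (θ t) := by rw [hℓ t]; simp
    have h1 : ℓ t 1 = (Real.sqrt (1 + δ^2))⁻¹ * sin (θ t) := by rw [hℓ t]; simp
    have h2 : ℓ t 2 = (Real.sqrt (1 + δ^2))⁻¹ * δ := by rw [hℓ t]; simp
    rw [h0, h1, h2]
    linear_combination (-(δ^2 * ((Real.sqrt (1 + δ^2))⁻¹)^2)) * Real.sin_sq_add_cos_sq (θ t)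
  refine ⟨key, ?_⟩
  have hv : H.mulVecLin ![δ^2, δ^2, -1, 0, 0, 0] = 0 := by
    ext t
    simp only [Matrix.mulVecLin_apply, Matrix.mulVec, dotProduct, hH t, Fin.sum_univ_six]
    simp
    linear_combination -(key t)
  have hne : (![δ^2, δ^2, -1, 0, 0, 0] : Fin 6 → ℝ) ≠ 0 := by
    intro h
    have := congrFun h 2
    simp at this
  have hsum := LinearMap.finrank_range_add_finrank_ker H.mulVecLin
  have hpos : 0 < Module.finrank ℝ (LinearMap.ker H.mulVecLin) := by
    rw [Module.finrank_pos_iff_exists_ne_zero]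
    exact ⟨⟨_, LinearMap.mem_ker.mpr hv⟩, fun h => hne (congrArg Subtype.val h)⟩
  rw [Module.finrank_fin_fun] at hsum
  unfold Matrix.rank
  omega
end

section
/- Let δ > 0, θ₁, …, θ_q ∈ [0, 2π), and ℓₜ = (1+δ²)^{-1/2} (cos θₜ, sin θₜ, δ)ᵀ for t = 1, …, q, with H ∈ ℝ^{q×6} the matrix whose t-th row is (ℓ_{1t}², ℓ_{2t}², ℓ_{3t}², 2ℓ_{1t}ℓ_{2t}, 2ℓ_{1t}ℓ_{3t}, 2ℓ_{2t}ℓ_{3t}). Then for any q (even q ≥ 6), if the linear system H g = 𝟙 (with 𝟙 = (1,…,1)ᵀ ∈ ℝ^q) has a solution g ∈ ℝ⁶, it has more than one solution; i.e., the solution is never unique. -/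
open Matrix Real

/-- For the circular lights placement `ℓₜ = (1+δ²)^{-1/2}(cos θₜ, sin θₜ, δ)ᵀ`,
whenever the linear system `H g = 𝟙` has a solution, it has more than one:
the solution is never unique (for any `q`, even `q ≥ 6`). -/
theorem stmt7 (q : ℕ) (δ : ℝ) (hδ : 0 < δ)
    (θ : Fin q → ℝ) (hθ : ∀ t, θ t ∈ Set.Ico 0 (2 * π))
    (ℓ : Fin q → Fin 3 → ℝ)
    (hℓ : ∀ t, ℓ t = fun i => (Real.sqrt (1 + δ^2))⁻¹ * ![cos (θ t), sin (θ t), δ] i)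
    (H : Matrix (Fin q) (Fin 6) ℝ)
    (hH : ∀ t, H t = ![(ℓ t 0)^2, (ℓ t 1)^2, (ℓ t 2)^2,
      2 * ℓ t 0 * ℓ t 1, 2 * ℓ t 0 * ℓ t 2, 2 * ℓ t 1 * ℓ t 2])
    (g : Fin 6 → ℝ) (hg : H.mulVec g = 1) :
    ∃ g' : Fin 6 → ℝ, g' ≠ g ∧ H.mulVec g' = 1 := by
  have h0 : H.mulVec ![δ^2, δ^2, -1, 0, 0, 0] = 0 := by
    funext t
    simp only [Matrix.mulVec, dotProduct, hH t, Fin.sum_univ_succ]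
    simp [hℓ t]
    linear_combination ((Real.sqrt (1 + δ^2))⁻¹ ^ 2 * δ^2) * Real.sin_sq_add_cos_sq (θ t)
  refine ⟨g + ![δ^2, δ^2, -1, 0, 0, 0], ?_, ?_⟩
  · intro h
    have := congrFun h 2
    simp at this
  · rw [Matrix.mulVec_add, hg, h0, add_zero]
end
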